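/- Let q, z be complex numbers with q ≠ 0, z ≠ 0, and let m, n ≥ 0 be integers. Assume q^j ≠ 1 for all 1 ≤ j ≤ m+n, and z·q^{k-1} ≠ 1 for all 1 ≤ k ≤ max(m,n). Then ∑_{k=1}^{n} (q/z;q)_k · (z;q)_{n-k} · (z;q)_m · z^k / ( (q;q)_k · (q;q)_{n-k} · (q^k;q)_{m+1} ) − ∑_{k=1}^{m} (q/z;q)_k · (z;q)_{m-k} · (z;q)_n · z^k / ( (q;q)_k · (q;q)_{m-k} · (q^k;q)_{n+1} ) = (1 − z·q^{-1}) · (z;q)_m · (z;q)_n / ((q;q)_m · (q;q)_n) · ( ∑_{k=1}^{m} q^k/((1−z·q^{k-1})(1−q^k)) − ∑_{k=1}^{n} q^k/((1−z·q^{k-1})(1−q^k)) ). -/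

import Mathlib

open Finset

/-- The q-Pochhammer symbol `(x;q)_N = ∏_{j=0}^{N-1} (1 - x q^j)`. -/
noncomputable def qPoch (q x : ℂ) (N : ℕ) : ℂ := ∏ j ∈ Finset.range N, (1 - x * q ^ j)

theorem qPoch_zero (q x : ℂ) : qPoch q x 0 = 1 := by simp [qPoch]

theorem qPoch_succ (q x : ℂ) (N : ℕ) : qPoch q x (N + 1) = qPoch q x N * (1 - x * q ^ N) := by
  simp [qPoch, prod_range_succ]

theorem qPoch_self_succ (q : ℂ) (N : ℕ) :
    qPoch q q (N + 1) = qPoch q q N * (1 - q ^ (N + 1)) := by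
  rw [qPoch_succ, pow_succ']

theorem qPoch_div_succ {q : ℂ} (hq : q ≠ 0) (x : ℂ) (N : ℕ) :
    qPoch q (x / q) (N + 1) = (1 - x / q) * qPoch q x N := by
  have h : ∀ j : ℕ, x / q * q ^ (j + 1) = x * q ^ j := fun j => by
    rw [pow_succ']
    field_simp
  simp [qPoch, prod_range_succ', h, mul_comm]

theorem qPoch_ne_zero {q x : ℂ} {N : ℕ} (h : ∀ j < N, x * q ^ j ≠ 1) : qPoch q x N ≠ 0 := by
  rw [qPoch, prod_ne_zero_iff]
  exact fun j hj => sub_ne_zero.2 (h j (mem_range.1 hj)).symm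

theorem qPoch_self_ne_zero {q : ℂ} {N : ℕ} (h : ∀ j, 1 ≤ j → j ≤ N → q ^ j ≠ 1) :
    qPoch q q N ≠ 0 :=
  qPoch_ne_zero fun j hj => by
    rw [← pow_succ']
    exact h _ (by omega) (by omega)

theorem qPoch_self_mul_qPoch_pow (q : ℂ) (k N : ℕ) :
    qPoch q q k * qPoch q (q ^ (k + 1)) N = qPoch q q (k + N) := by
  induction N with
  | zero => simp [qPoch_zero]
  | succ N ih =>
    rw [qPoch_succ, ← mul_assoc, ih, ← add_assoc, qPoch_self_succ]
    ring

theorem qPoch_self_mul_qPoch_pow_succ (q : ℂ) (k N : ℕ) :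
    qPoch q q (k + 1) * qPoch q (q ^ (k + 1)) (N + 1)
      = (1 - q ^ (k + 1)) * qPoch q q (k + 1 + N) := by
  rw [qPoch_self_succ, mul_right_comm, qPoch_self_mul_qPoch_pow, mul_comm]
  congr 2
  omega

/-- The polynomial `z^k (q/z;q)_k = (z - q) ⋯ (z - q^k)`. -/
noncomputable def shiftedPow (q z : ℂ) (k : ℕ) : ℂ := qPoch q (q / z) k * z ^ k

theorem shiftedPow_zero (q z : ℂ) : shiftedPow q z 0 = 1 := by simp [shiftedPow, qPoch_zero]

theorem shiftedPow_succ (q : ℂ) {z : ℂ} (hz : z ≠ 0) (k : ℕ) :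
    shiftedPow q z (k + 1) = shiftedPow q z k * (z - q ^ (k + 1)) := by
  rw [shiftedPow, shiftedPow, qPoch_succ]
  field_simp
  ring

/-- The summand obtained by differencing the weighted sum in its denominator parameter. -/
noncomputable def lowerTerm (q z : ℂ) (n m k : ℕ) : ℂ :=
  shiftedPow q z k * qPoch q z (n - k) / (qPoch q q (n - k) * qPoch q q (k + m))

/-- The summand obtained by differencing the weighted sum in its length. -/
noncomputable def lengthTerm (q z : ℂ) (n m k : ℕ) : ℂ :=
  q ^ (m - k) * shiftedPow q z k * qPoch q (z / q) (m - k)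
    / (qPoch q q (m - k) * qPoch q q (k + n))

theorem one_sub_pow_ne_zero {q : ℂ} {N j : ℕ} (h : ∀ j, 1 ≤ j → j ≤ N → q ^ j ≠ 1)
    (h1 : 1 ≤ j) (h2 : j ≤ N) : 1 - q ^ j ≠ 0 :=
  sub_ne_zero.2 (h j h1 h2).symm

theorem sum_lowerTerm_succ {q z : ℂ} (hq : q ≠ 0) (hz : z ≠ 0) (n m : ℕ)
    (h : ∀ j, 1 ≤ j → j ≤ m + (n + 1) → q ^ j ≠ 1) :
    (1 - q ^ (n + 1)) * ∑ k ∈ range (n + 1), lowerTerm q z n m k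
      - (1 - q ^ (m + n + 1)) * ∑ k ∈ range (n + 2), lowerTerm q z (n + 1) m k
      = -(q ^ (n + 1) * (1 - q ^ m) * qPoch q z (n + 1) / (qPoch q q (n + 1) * qPoch q q m)) := by
  set g : ℕ → ℂ := fun k => lowerTerm q z (n + 1) m k * (1 - q ^ (k + m)) / q ^ k with hg
  have key : ∀ k ∈ range (n + 1), (1 - q ^ (n + 1)) * lowerTerm q z n m k
      - (1 - q ^ (m + n + 1)) * lowerTerm q z (n + 1) m k
      = q ^ (n + 1) * (g (k + 1) - g k) := by
    intro k hk
    obtain ⟨d, rfl⟩ := Nat.exists_eq_add_of_le (Nat.lt_succ_iff.1 (mem_range.1 hk))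
    have e1 : k + d - k = d := by omega
    have e2 : k + d + 1 - k = d + 1 := by omega
    have e3 : k + d + 1 - (k + 1) = d := by omega
    have e4 : k + 1 + m = k + m + 1 := by omega
    have h1 : qPoch q q d ≠ 0 := qPoch_self_ne_zero fun j a b => h j a (by omega)
    have h2 : qPoch q q (k + m) ≠ 0 := qPoch_self_ne_zero fun j a b => h j a (by omega)
    have h3 := one_sub_pow_ne_zero h (j := d + 1) (by omega) (by omega)
    have h4 := one_sub_pow_ne_zero h (j := k + m + 1) (by omega) (by omega)
    simp only [hg, lowerTerm, e1, e2, e3, e4, shiftedPow_succ q hz, qPoch_succ q z,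
      qPoch_self_succ]
    field_simp
    ring
  have last : (1 - q ^ (m + n + 1)) * lowerTerm q z (n + 1) m (n + 1)
      = q ^ (n + 1) * g (n + 1) := by
    simp only [hg]
    field_simp
    ring
  have first : g 0 = (1 - q ^ m) * qPoch q z (n + 1) / (qPoch q q (n + 1) * qPoch q q m) := by
    simp [hg, lowerTerm, shiftedPow_zero]
    ring
  have tel := sum_congr rfl key
  rw [sum_sub_distrib, ← mul_sum, ← mul_sum, ← mul_sum, sum_range_sub] at tel
  rw [sum_range_succ _ (n + 1), mul_add, last]
  linear_combination tel - q ^ (n + 1) * first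

theorem sum_lengthTerm_succ {q z : ℂ} (hq : q ≠ 0) (hz : z ≠ 0) (n m : ℕ)
    (h : ∀ j, 1 ≤ j → j ≤ m + (n + 1) → q ^ j ≠ 1) :
    (1 - q ^ (n + 1)) * ∑ k ∈ range (m + 1), lengthTerm q z n m k
      - (1 - z * q ^ n) * (1 - q ^ (m + n + 1)) * ∑ k ∈ range (m + 1), lengthTerm q z (n + 1) m k
      = -(q ^ (m + n) * (q - z) * qPoch q z m / (qPoch q q m * qPoch q q n)) := by
  set g : ℕ → ℂ := fun k => lengthTerm q z n m k * (q - z * q ^ m / q ^ k) with hg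
  have key : ∀ k ∈ range m, (1 - q ^ (n + 1)) * lengthTerm q z n m k
      - (1 - z * q ^ n) * (1 - q ^ (m + n + 1)) * lengthTerm q z (n + 1) m k
      = q ^ n * (g (k + 1) - g k) := by
    intro k hk
    obtain ⟨d, rfl⟩ := Nat.exists_eq_add_of_lt (mem_range.1 hk)
    have e2 : k + d + 1 - k = d + 1 := by omega
    have e3 : k + d + 1 - (k + 1) = d := by omega
    have e4 : k + 1 + n = k + n + 1 := by omega
    have e5 : k + (n + 1) = k + n + 1 := by omega
    have h1 : qPoch q q d ≠ 0 := qPoch_self_ne_zero fun j a b => h j a (by omega)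
    have h2 : qPoch q q (k + n) ≠ 0 := qPoch_self_ne_zero fun j a b => h j a (by omega)
    have h3 := one_sub_pow_ne_zero h (j := d + 1) (by omega) (by omega)
    have h4 := one_sub_pow_ne_zero h (j := k + n + 1) (by omega) (by omega)
    simp only [hg, lengthTerm, e2, e3, e4, e5, shiftedPow_succ q hz, qPoch_succ q (z / q),
      qPoch_self_succ]
    field_simp
    ring
  have last : (1 - q ^ (n + 1)) * lengthTerm q z n m m
      - (1 - z * q ^ n) * (1 - q ^ (m + n + 1)) * lengthTerm q z (n + 1) m m
      = -(q ^ n * g m) := by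
    have h2 : qPoch q q (m + n) ≠ 0 := qPoch_self_ne_zero fun j a b => h j a (by omega)
    have h4 := one_sub_pow_ne_zero h (j := m + n + 1) (by omega) (by omega)
    simp only [hg, lengthTerm, ← add_assoc, qPoch_self_succ, Nat.sub_self, qPoch_zero]
    field_simp
    ring
  have first : g 0 = q ^ m * (q - z) * qPoch q z m / (qPoch q q m * qPoch q q n) := by
    have hs : qPoch q (z / q) m * (q - z * q ^ m) = (q - z) * qPoch q z m := by
      have := qPoch_succ q (z / q) m
      rw [qPoch_div_succ hq] at this
      field_simp at this
      linear_combination -this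
    simp only [hg, lengthTerm, shiftedPow_zero, Nat.sub_zero, zero_add, pow_zero, div_one, mul_one]
    rw [mul_assoc, ← hs]
    ring
  have tel := sum_congr rfl key
  rw [sum_sub_distrib, ← mul_sum, ← mul_sum, ← mul_sum, sum_range_sub] at tel
  rw [sum_range_succ _ m, sum_range_succ _ m]
  linear_combination tel + last - q ^ n * first

theorem sum_lengthTerm_zero {q z : ℂ} (hq : q ≠ 0) (hz : z ≠ 0) (m : ℕ)
    (h : ∀ j, 1 ≤ j → j ≤ m + 1 → q ^ j ≠ 1) :
    ∑ k ∈ range (m + 2), lengthTerm q z 0 (m + 1) k = 0 := by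
  by_cases hzq : q = z
  · subst hzq
    refine sum_eq_zero fun k _ => ?_
    rcases k with _ | k
    · have : qPoch q 1 (m + 1) = 0 := by simp [qPoch, prod_range_succ']
      simp [lengthTerm, hq, this]
    · have : qPoch q 1 (k + 1) = 0 := by simp [qPoch, prod_range_succ']
      simp [lengthTerm, shiftedPow, hq, this]
  set g : ℕ → ℂ := fun k => lengthTerm q z 0 (m + 1) k * (1 - q ^ k) * (q - z * q ^ (m + 1) / q ^ k)
    with hg
  have key : ∀ k ∈ range (m + 1), -((q - z) * (1 - q ^ (m + 1))) * lengthTerm q z 0 (m + 1) k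
      = g (k + 1) - g k := by
    intro k hk
    obtain ⟨d, rfl⟩ := Nat.exists_eq_add_of_le (Nat.lt_succ_iff.1 (mem_range.1 hk))
    have e2 : k + d + 1 - k = d + 1 := by omega
    have e3 : k + d + 1 - (k + 1) = d := by omega
    have h1 : qPoch q q d ≠ 0 := qPoch_self_ne_zero fun j a b => h j a (by omega)
    have h2 : qPoch q q k ≠ 0 := qPoch_self_ne_zero fun j a b => h j a (by omega)
    have h3 := one_sub_pow_ne_zero h (j := d + 1) (by omega) (by omega)
    have h4 := one_sub_pow_ne_zero h (j := k + 1) (by omega) (by omega)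
    simp only [hg, lengthTerm, e2, e3, add_zero, shiftedPow_succ q hz, qPoch_succ q (z / q),
      qPoch_self_succ]
    field_simp
    ring
  have last : -((q - z) * (1 - q ^ (m + 1))) * lengthTerm q z 0 (m + 1) (m + 1)
      = - g (m + 1) := by
    simp only [hg]
    field_simp
  have first : g 0 = 0 := by simp [hg]
  have tel := sum_congr rfl key
  rw [← mul_sum, sum_range_sub] at tel
  have hne : -((q - z) * (1 - q ^ (m + 1))) ≠ 0 :=
    neg_ne_zero.2 (mul_ne_zero (sub_ne_zero.2 hzq) (one_sub_pow_ne_zero h (by omega) le_rfl))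
  refine (mul_eq_zero.1 ?_).resolve_left hne
  rw [sum_range_succ, mul_add]
  linear_combination tel + last - first

theorem sum_lowerTerm_add_sum_lengthTerm {q z : ℂ} (hq : q ≠ 0) (hz : z ≠ 0) (n m : ℕ)
    (h : ∀ j, 1 ≤ j → j ≤ m + 1 + n → q ^ j ≠ 1) :
    q ^ (m + 1) * qPoch q z (m + 1) * ∑ k ∈ range (n + 1), lowerTerm q z n (m + 1) k
      + qPoch q z n * ∑ k ∈ range (m + 2), lengthTerm q z n (m + 1) k
      = q ^ (m + 1) * qPoch q z (m + 1) * qPoch q z n / (qPoch q q (m + 1) * qPoch q q n) := by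
  induction n with
  | zero =>
    rw [sum_lengthTerm_zero hq hz m h]
    simp [lowerTerm, shiftedPow_zero, qPoch_zero]
    ring
  | succ n ih =>
    have ih := ih fun j a b => h j a (by omega)
    have h1 := sum_lowerTerm_succ hq hz n (m + 1) h
    have h2 := sum_lengthTerm_succ hq hz n (m + 1) h
    have hne := one_sub_pow_ne_zero h (j := m + 1 + n + 1) (by omega) (by omega)
    have h3 := one_sub_pow_ne_zero h (j := n + 1) (by omega) (by omega)
    have h4 : qPoch q q n ≠ 0 := qPoch_self_ne_zero fun j a b => h j a (by omega)
    have h5 : qPoch q q (m + 1) ≠ 0 := qPoch_self_ne_zero fun j a b => h j a (by omega)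
    refine mul_left_cancel₀ hne ?_
    rw [qPoch_succ q z n, qPoch_self_succ q n] at *
    have aux : (1 - q ^ (n + 1)) * (q ^ (m + 1) * qPoch q z (m + 1) * qPoch q z n
          / (qPoch q q (m + 1) * qPoch q q n))
        + q ^ (m + 1) * qPoch q z (m + 1) * (q ^ (n + 1) * (1 - q ^ (m + 1))
          * (qPoch q z n * (1 - z * q ^ n))
          / (qPoch q q n * (1 - q ^ (n + 1)) * qPoch q q (m + 1)))
        + qPoch q z n * (q ^ (m + 1 + n) * (q - z) * qPoch q z (m + 1)
          / (qPoch q q (m + 1) * qPoch q q n))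
        = (1 - q ^ (m + 1 + n + 1)) * (q ^ (m + 1) * qPoch q z (m + 1)
          * (qPoch q z n * (1 - z * q ^ n))
          / (qPoch q q (m + 1) * (qPoch q q n * (1 - q ^ (n + 1))))) := by
      generalize qPoch q z (m + 1) = A
      generalize qPoch q q (m + 1) = B at *
      field_simp
      ring
    rw [← aux, ← ih]
    linear_combination -(q ^ (m + 1) * qPoch q z (m + 1)) * h1 - qPoch q z n * h2

/-- One of the two sums of the identity, normalized so that their difference separates in `n`
and `m`. -/
noncomputable def normalizedSum (q z : ℂ) (n m : ℕ) : ℂ :=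
  qPoch q q m * qPoch q q n / qPoch q z n * ∑ k ∈ range n,
    shiftedPow q z (k + 1) * qPoch q z (n - (k + 1))
      / (qPoch q q (n - (k + 1)) * ((1 - q ^ (k + 1)) * qPoch q q (k + 1 + m)))

theorem normalizedSum_succ_right {q z : ℂ} (n m : ℕ)
    (h : ∀ j, 1 ≤ j → j ≤ m + 1 + n → q ^ j ≠ 1) (hn : qPoch q z n ≠ 0) :
    normalizedSum q z n (m + 1) - normalizedSum q z n m
      = -(q ^ (m + 1) * qPoch q q m * qPoch q q n / qPoch q z n
          * ∑ k ∈ range (n + 1), lowerTerm q z n (m + 1) k)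
        + q ^ (m + 1) / (1 - q ^ (m + 1)) := by
  have h1 : qPoch q q n ≠ 0 := qPoch_self_ne_zero fun j a b => h j a (by omega)
  have h2 : qPoch q q m ≠ 0 := qPoch_self_ne_zero fun j a b => h j a (by omega)
  have h3 := one_sub_pow_ne_zero h (j := m + 1) (by omega) (by omega)
  have zeroth : q ^ (m + 1) / (1 - q ^ (m + 1))
      = q ^ (m + 1) * qPoch q q m * qPoch q q n / qPoch q z n * lowerTerm q z n (m + 1) 0 := by
    simp only [lowerTerm, shiftedPow_zero, Nat.sub_zero, zero_add, qPoch_self_succ]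
    field_simp
  rw [zeroth, sum_range_succ', normalizedSum, normalizedSum, mul_add, neg_add,
    neg_add_cancel_right, mul_sum, mul_sum, mul_sum, ← sum_sub_distrib, ← sum_neg_distrib]
  refine sum_congr rfl fun k hk => ?_
  have hk := mem_range.1 hk
  have h4 : qPoch q q (n - (k + 1)) ≠ 0 := qPoch_self_ne_zero fun j a b => h j a (by omega)
  have h5 : qPoch q q (k + 1 + m) ≠ 0 := qPoch_self_ne_zero fun j a b => h j a (by omega)
  have h6 := one_sub_pow_ne_zero h (j := k + 1) (by omega) (by omega)
  have h7 := one_sub_pow_ne_zero h (j := k + 1 + m + 1) (by omega) (by omega)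
  simp only [lowerTerm, ← add_assoc, qPoch_self_succ q m, qPoch_self_succ q (k + 1 + m)]
  generalize qPoch q q (n - (k + 1)) = A at *
  generalize qPoch q q (k + 1 + m) = B at *
  field_simp
  ring

theorem normalizedSum_succ_left {q z : ℂ} (hq : q ≠ 0) (n m : ℕ)
    (h : ∀ j, 1 ≤ j → j ≤ m + 1 + n → q ^ j ≠ 1) (hm : qPoch q z (m + 1) ≠ 0) :
    normalizedSum q z (m + 1) n - normalizedSum q z m n
      = qPoch q q m * qPoch q q n / qPoch q z (m + 1)
          * ∑ k ∈ range (m + 2), lengthTerm q z n (m + 1) k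
        - (1 - z * q⁻¹) * (q ^ (m + 1) / ((1 - z * q ^ m) * (1 - q ^ (m + 1)))) := by
  have h1 : qPoch q q n ≠ 0 := qPoch_self_ne_zero fun j a b => h j a (by omega)
  have h2 : qPoch q q m ≠ 0 := qPoch_self_ne_zero fun j a b => h j a (by omega)
  have h3 := one_sub_pow_ne_zero h (j := m + 1) (by omega) (by omega)
  rw [qPoch_succ] at hm
  obtain ⟨hm1, hm2⟩ := mul_ne_zero_iff.1 hm
  have zeroth : (1 - z * q⁻¹) * (q ^ (m + 1) / ((1 - z * q ^ m) * (1 - q ^ (m + 1))))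
      = qPoch q q m * qPoch q q n / qPoch q z (m + 1) * lengthTerm q z n (m + 1) 0 := by
    simp only [lengthTerm, shiftedPow_zero, Nat.sub_zero, zero_add, qPoch_self_succ,
      qPoch_div_succ hq, qPoch_succ q z]
    field_simp
  rw [zeroth, sum_range_succ' _ (m + 1), mul_add, add_sub_cancel_right, normalizedSum,
    normalizedSum, sum_range_succ, sum_range_succ _ m, mul_add, mul_add, add_sub_right_comm]
  congr 1
  · rw [mul_sum, mul_sum, mul_sum, ← sum_sub_distrib]
    refine sum_congr rfl fun k hk => ?_
    obtain ⟨d, rfl⟩ := Nat.exists_eq_add_of_lt (mem_range.1 hk)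
    have e2 : k + d + 1 + 1 - (k + 1) = d + 1 := by omega
    have e3 : k + d + 1 - (k + 1) = d := by omega
    have h4 : qPoch q q d ≠ 0 := qPoch_self_ne_zero fun j a b => h j a (by omega)
    have h5 : qPoch q q (k + 1 + n) ≠ 0 := qPoch_self_ne_zero fun j a b => h j a (by omega)
    have h6 := one_sub_pow_ne_zero h (j := k + 1) (by omega) (by omega)
    have h7 := one_sub_pow_ne_zero h (j := d + 1) (by omega) (by omega)
    simp only [lengthTerm, e2, e3, qPoch_div_succ hq, qPoch_self_succ q (k + d + 1),
      qPoch_self_succ q d, qPoch_succ q z (k + d + 1), qPoch_succ q z d]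
    generalize qPoch q q (k + d + 1) = A at *
    generalize qPoch q z (k + d + 1) = A' at *
    generalize qPoch q q (k + 1 + n) = B at *
    field_simp
    ring
  · have h5 : qPoch q q (m + 1 + n) ≠ 0 := qPoch_self_ne_zero fun j a b => h j a (by omega)
    simp only [lengthTerm, Nat.sub_self, qPoch_zero, qPoch_self_succ q m, pow_zero]
    generalize qPoch q q (m + 1 + n) = B at *
    generalize qPoch q z (m + 1) = C at *
    field_simp

theorem normalizedSum_sub_succ {q z : ℂ} (hq : q ≠ 0) (hz : z ≠ 0) (n m : ℕ)
    (h : ∀ j, 1 ≤ j → j ≤ m + 1 + n → q ^ j ≠ 1) (hn : qPoch q z n ≠ 0)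
    (hm : qPoch q z (m + 1) ≠ 0) :
    normalizedSum q z n (m + 1) - normalizedSum q z (m + 1) n
      = normalizedSum q z n m - normalizedSum q z m n
        + (1 - z * q⁻¹) * (q ^ (m + 1) / ((1 - z * q ^ m) * (1 - q ^ (m + 1)))) := by
  have h1 : qPoch q q n ≠ 0 := qPoch_self_ne_zero fun j a b => h j a (by omega)
  have h2 : qPoch q q m ≠ 0 := qPoch_self_ne_zero fun j a b => h j a (by omega)
  have h3 := one_sub_pow_ne_zero h (j := m + 1) (by omega) (by omega)
  have hR := normalizedSum_succ_right n m h hn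
  have hL := normalizedSum_succ_left hq n m h hm
  have hE := sum_lowerTerm_add_sum_lengthTerm hq hz n m h
  have key : q ^ (m + 1) * qPoch q q m * qPoch q q n / qPoch q z n
        * ∑ k ∈ range (n + 1), lowerTerm q z n (m + 1) k
      + qPoch q q m * qPoch q q n / qPoch q z (m + 1)
        * ∑ k ∈ range (m + 2), lengthTerm q z n (m + 1) k
      = q ^ (m + 1) / (1 - q ^ (m + 1)) := by
    rw [qPoch_self_succ] at hE
    generalize ∑ k ∈ range (n + 1), lowerTerm q z n (m + 1) k = X at *
    generalize ∑ k ∈ range (m + 2), lengthTerm q z n (m + 1) k = Y at *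
    generalize qPoch q z (m + 1) = C at *
    field_simp at hE ⊢
    linear_combination hE
  linear_combination hR - hL - key

theorem normalizedSum_sub {q z : ℂ} (hq : q ≠ 0) (hz : z ≠ 0) (n m : ℕ)
    (h : ∀ j, 1 ≤ j → j ≤ m + n → q ^ j ≠ 1) (hn : qPoch q z n ≠ 0)
    (hm : ∀ k ≤ m, qPoch q z k ≠ 0) :
    normalizedSum q z n m - normalizedSum q z m n
      = normalizedSum q z n 0 - normalizedSum q z 0 n
        + (1 - z * q⁻¹) * ∑ k ∈ range m, q ^ (k + 1) / ((1 - z * q ^ k) * (1 - q ^ (k + 1))) := by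
  induction m with
  | zero => simp
  | succ m ih =>
    rw [normalizedSum_sub_succ hq hz n m h hn (hm _ le_rfl),
      ih (fun j a b => h j a (by omega)) fun k hk => hm k (by omega), sum_range_succ]
    ring

theorem sum_Icc_one (f : ℕ → ℂ) (n : ℕ) : ∑ k ∈ Icc 1 n, f k = ∑ k ∈ range n, f (k + 1) := by
  induction n with
  | zero => simp
  | succ n ih => rw [sum_Icc_succ_top (by omega), ih, sum_range_succ]

theorem sum_eq_normalizedSum {q z : ℂ} (n m : ℕ) (hn : qPoch q z n ≠ 0)
    (h : ∀ j, 1 ≤ j → j ≤ m + n → q ^ j ≠ 1) :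
    ∑ k ∈ Icc 1 n, qPoch q (q / z) k * qPoch q z (n - k) * qPoch q z m * z ^ k
        / (qPoch q q k * qPoch q q (n - k) * qPoch q (q ^ k) (m + 1))
      = qPoch q z m * qPoch q z n / (qPoch q q m * qPoch q q n) * normalizedSum q z n m := by
  have h1 : qPoch q q n ≠ 0 := qPoch_self_ne_zero fun j a b => h j a (by omega)
  have h2 : qPoch q q m ≠ 0 := qPoch_self_ne_zero fun j a b => h j a (by omega)
  have hc : qPoch q z m * qPoch q z n / (qPoch q q m * qPoch q q n)
      * (qPoch q q m * qPoch q q n / qPoch q z n) = qPoch q z m := by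
    field_simp
  rw [sum_Icc_one, normalizedSum, ← mul_assoc, hc, mul_sum]
  refine sum_congr rfl fun k _ => ?_
  rw [mul_right_comm (qPoch q q (k + 1)), qPoch_self_mul_qPoch_pow_succ, shiftedPow]
  ring

theorem stmt_16 (q z : ℂ) (hq : q ≠ 0) (hz : z ≠ 0) (m n : ℕ)
    (hq1 : ∀ j : ℕ, 1 ≤ j → j ≤ m + n → q ^ j ≠ 1)
    (hz1 : ∀ k : ℕ, 1 ≤ k → k ≤ max m n → z * q ^ (k - 1) ≠ 1) :
    (∑ k ∈ Finset.Icc 1 n,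
        qPoch q (q / z) k * qPoch q z (n - k) * qPoch q z m * z ^ k
          / (qPoch q q k * qPoch q q (n - k) * qPoch q (q ^ k) (m + 1)))
      - (∑ k ∈ Finset.Icc 1 m,
          qPoch q (q / z) k * qPoch q z (m - k) * qPoch q z n * z ^ k
            / (qPoch q q k * qPoch q q (m - k) * qPoch q (q ^ k) (n + 1)))
      = (1 - z * q⁻¹) * qPoch q z m * qPoch q z n / (qPoch q q m * qPoch q q n)
          * ((∑ k ∈ Finset.Icc 1 m, q ^ k / ((1 - z * q ^ (k - 1)) * (1 - q ^ k)))
             - ∑ k ∈ Finset.Icc 1 n, q ^ k / ((1 - z * q ^ (k - 1)) * (1 - q ^ k))) := by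
  have hp : ∀ k ≤ max m n, qPoch q z k ≠ 0 := fun k hk =>
    qPoch_ne_zero fun j hj => hz1 (j + 1) (by omega) (by omega)
  have hn := hp n (le_max_right m n)
  have hm := hp m (le_max_left m n)
  have hq2 : ∀ j : ℕ, 1 ≤ j → j ≤ n + m → q ^ j ≠ 1 := fun j a b => hq1 j a (by omega)
  have key := normalizedSum_sub hq hz n m hq1 hn fun k hk => hp k (by omega)
  have bdry := normalizedSum_sub hq hz 0 n (fun j a b => hq1 j a (by omega))
    (hp 0 (by omega)) fun k hk => hp k (by omega)
  rw [sum_eq_normalizedSum n m hn hq1, sum_eq_normalizedSum m n hm hq2, sum_Icc_one, sum_Icc_one]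
  simp only [Nat.add_sub_cancel]
  linear_combination qPoch q z m * qPoch q z n / (qPoch q q m * qPoch q q n) * (key - bdry)
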